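/- Corollary 1 (density of w-coprime S-integers): for integers w, m ≥ 1 with wm ≥ 2, the ratio V_m^w(N⃗) / q^{m ℓ(D(N⃗))} tends to 1/ζ_S(wm) as N = deg D(N⃗) → ∞. In other words, the probability that m random elements of L(D(N⃗)) are w-coprime tends to 1/ζ_S(wm). -/

import Mathlib

section FunctionFieldModel

variable {Fq K Place : Type*} [Field Fq] [Fintype Fq] [Field K] [Algebra Fq K]

/-- The degree of a divisor `D = ∑ c_𝔭 𝔭` of the function field,
namely `∑ c_𝔭 deg 𝔭`. Divisors are modelled as finitely supported
`ℤ`-valued functions on the type `Place` of prime divisors of `K`. -/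
def divDeg (deg : Place → ℕ) (D : Place →₀ ℤ) : ℤ :=
  D.sum fun p n => n * (deg p : ℤ)

/-- The Riemann-Roch space `L(D) = {a ∈ K^× : (a) + D ≥ 0} ∪ {0}`,
where `prin u` is the principal divisor of the nonzero element `u`. -/
def Lset (prin : Kˣ → (Place →₀ ℤ)) (D : Place →₀ ℤ) : Set K :=
  {a : K | a = 0 ∨ ∃ u : Kˣ, (u : K) = a ∧ 0 ≤ prin u + D}

end FunctionFieldModel

/-- The divisor `D(N⃗) = ∑_j N_j 𝔭_j`. -/
noncomputable def DofN {Place : Type*} [DecidableEq Place] (S : Finset Place)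
    (Nv : Place → ℤ) : Place →₀ ℤ :=
  ∑ p ∈ S, Finsupp.single p (Nv p)

/-- `a₁, …, a_m ∈ 𝒪_S` are `w`-coprime if `⟨a₁, …, a_m⟩_S ⊆ 𝔮^w` for no prime
ideal `𝔮` of `𝒪_S` (prime ideals correspond to prime divisors `p ∉ S`). -/
def wCoprimeElems {K Place : Type*} [Field K] (prin : Kˣ → (Place →₀ ℤ))
    (S : Finset Place) (w : ℕ) {m : ℕ} (f : Fin m → K) : Prop :=
  ¬ ∃ p : Place, p ∉ S ∧ ∀ l : Fin m,
      f l = 0 ∨ ∃ u : Kˣ, (u : K) = f l ∧ (w : ℤ) ≤ prin u p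


structure RRM {K Place : Type*} [Field K] (q : ℕ) (deg : Place → ℕ)
    (prin : Kˣ → (Place →₀ ℤ)) (ell : (Place →₀ ℤ) → ℕ) (g : ℕ) (Can : Place →₀ ℤ) : Prop where
  hq : 2 ≤ q
  hdeg : ∀ p, 0 < deg p
  hfin : ∀ n : ℕ, {p : Place | deg p ≤ n}.Finite
  hdegprin : ∀ u : Kˣ, divDeg deg (prin u) = 0
  hell : ∀ D : Place →₀ ℤ, Nat.card (Lset prin D) = q ^ ell D
  hRR : ∀ D : Place →₀ ℤ, (ell D : ℤ) = divDeg deg D - g + 1 + ell (Can - D)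
  hCan : divDeg deg Can = 2 * (g : ℤ) - 2

theorem divDeg_add' {Place : Type*} (deg : Place → ℕ) (D E : Place →₀ ℤ) :
    divDeg deg (D + E) = divDeg deg D + divDeg deg E := by
  unfold divDeg
  exact Finsupp.sum_add_index' (by simp) (by intros; ring)

theorem divDeg_sub' {Place : Type*} (deg : Place → ℕ) (D E : Place →₀ ℤ) :
    divDeg deg (D - E) = divDeg deg D - divDeg deg E := by
  have := divDeg_add' deg (D - E) E
  rw [sub_add_cancel] at this
  omega

theorem divDeg_single' {Place : Type*} (deg : Place → ℕ) (p : Place) (n : ℤ) :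
    divDeg deg (Finsupp.single p n) = n * deg p := by
  unfold divDeg
  exact Finsupp.sum_single_index (by simp)

theorem divDeg_DofN {Place : Type*} [DecidableEq Place] (deg : Place → ℕ) (S : Finset Place)
    (Nv : Place → ℤ) : divDeg deg (DofN S Nv) = ∑ p ∈ S, Nv p * (deg p : ℤ) := by
  unfold DofN
  induction S using Finset.induction_on with
  | empty => simp [divDeg]
  | insert a s ha ih => rw [Finset.sum_insert ha, Finset.sum_insert ha, divDeg_add', ih, divDeg_single']

theorem DofN_apply {Place : Type*} [DecidableEq Place] (S : Finset Place)
    (Nv : Place → ℤ) (p : Place) (hp : p ∉ S) : DofN S Nv p = 0 := by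
  unfold DofN
  rw [Finsupp.finsetSum_apply]
  refine Finset.sum_eq_zero fun x hx => ?_
  rw [Finsupp.single_apply, if_neg]
  rintro rfl; exact hp hx

theorem sum_deg_le {Place : Type*} (deg : Place → ℕ) (D : Place →₀ ℤ) (hD : 0 ≤ D)
    (F : Finset Place) (hF : ∀ p ∈ F, 1 ≤ D p) : ∑ p ∈ F, (deg p : ℤ) ≤ divDeg deg D := by
  have hsub : F ⊆ D.support := by
    intro p hp
    rw [Finsupp.mem_support_iff]
    have := hF p hp
    omega
  unfold divDeg Finsupp.sum
  calc ∑ p ∈ F, (deg p : ℤ) ≤ ∑ p ∈ F, D p * (deg p : ℤ) := by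
        refine Finset.sum_le_sum fun p hp => ?_
        have := hF p hp
        nlinarith [Int.natCast_nonneg (deg p)]
    _ ≤ _ := by
        refine Finset.sum_le_sum_of_subset_of_nonneg hsub fun p _ _ => ?_
        exact mul_nonneg (hD p) (Int.natCast_nonneg _)

theorem divDeg_nonneg {Place : Type*} (deg : Place → ℕ) (D : Place →₀ ℤ) (hD : 0 ≤ D) :
    0 ≤ divDeg deg D := by
  simpa using sum_deg_le deg D hD ∅ (by simp)

theorem Lset_mono {K Place : Type*} [Field K] (prin : Kˣ → (Place →₀ ℤ)) {D E : Place →₀ ℤ}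
    (h : D ≤ E) : Lset prin D ⊆ Lset prin E := by
  rintro a (ha | ⟨u, hu, h0⟩)
  · exact Or.inl ha
  · exact Or.inr ⟨u, hu, h0.trans (by gcongr)⟩

section
variable {K Place : Type*} [Field K] {q : ℕ} {deg : Place → ℕ}
    {prin : Kˣ → (Place →₀ ℤ)} {ell : (Place →₀ ℤ) → ℕ} {g : ℕ} {Can : Place →₀ ℤ}

theorem RRM.finite (M : RRM q deg prin ell g Can) (D : Place →₀ ℤ) : (Lset prin D).Finite := by
  have h := M.hell D
  have : 0 < q ^ ell D := Nat.pow_pos (by have := M.hq; omega)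
  have : Nat.card (Lset prin D) ≠ 0 := by omega
  exact Nat.finite_of_card_ne_zero this

theorem RRM.ncard (M : RRM q deg prin ell g Can) (D : Place →₀ ℤ) :
    (Lset prin D).ncard = q ^ ell D := M.hell D

theorem RRM.eq_zero (M : RRM q deg prin ell g Can) (D : Place →₀ ℤ) (hD : divDeg deg D < 0)
    (a : K) (ha : a ∈ Lset prin D) : a = 0 := by
  rcases ha with ha | ⟨u, hu, h0⟩
  · exact ha
  · have := divDeg_nonneg deg _ h0
    rw [divDeg_add', M.hdegprin] at this
    omega

theorem RRM.ell_neg (M : RRM q deg prin ell g Can) (D : Place →₀ ℤ) (hD : divDeg deg D < 0) :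
    ell D = 0 := by
  have h : Lset prin D = {0} := by
    ext a
    exact ⟨M.eq_zero D hD a, fun h => Or.inl h⟩
  have h2 := M.ncard D
  rw [h, Set.ncard_singleton] at h2
  by_contra hne
  have := Nat.one_lt_pow hne (show 1 < q by have := M.hq; omega)
  omega

theorem RRM.ell_large (M : RRM q deg prin ell g Can) (D : Place →₀ ℤ)
    (hD : 2 * (g : ℤ) - 1 ≤ divDeg deg D) : (ell D : ℤ) = divDeg deg D - g + 1 := by
  have h := M.hRR D
  rw [M.ell_neg (Can - D) (by rw [divDeg_sub', M.hCan]; omega)] at h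
  simpa using h

theorem RRM.ell_mono (M : RRM q deg prin ell g Can) {D E : Place →₀ ℤ} (h : D ≤ E) :
    ell D ≤ ell E := by
  have h1 := Set.ncard_le_ncard (Lset_mono prin h) (M.finite E)
  rw [M.ncard, M.ncard] at h1
  exact (Nat.pow_le_pow_iff_right (by have := M.hq; omega)).1 h1

theorem RRM.ell_le (M : RRM q deg prin ell g Can) (P : Place) :
    ∃ C : ℕ, ∀ D : Place →₀ ℤ, 0 ≤ divDeg deg D → (ell D : ℤ) ≤ divDeg deg D + C := by
  refine ⟨2 * g * deg P + 1, fun D hD => ?_⟩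
  have h1 := M.ell_mono (D := D) (E := D + Finsupp.single P (2 * (g : ℤ))) (by
    refine le_add_of_nonneg_right ?_
    exact Finsupp.single_nonneg.2 (by positivity))
  have hP := M.hdeg P
  have h2 := M.ell_large (D + Finsupp.single P (2 * (g : ℤ))) (by
    rw [divDeg_add', divDeg_single']
    have : (1 : ℤ) ≤ deg P := by exact_mod_cast hP
    nlinarith [Int.natCast_nonneg g])
  rw [divDeg_add', divDeg_single'] at h2
  push_cast
  omega

theorem RRM.exists_unit (M : RRM q deg prin ell g Can) (D : Place →₀ ℤ)
    (hD : (g : ℤ) ≤ divDeg deg D) : ∃ u : Kˣ, 0 ≤ prin u + D := by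
  have h := M.hRR D
  have h1 : 1 ≤ ell D := by omega
  have h2 := M.ncard D
  have h3 : 1 < (Lset prin D).ncard := by
    rw [h2]
    exact Nat.one_lt_pow (by omega) (show 1 < q by have := M.hq; omega)
  obtain ⟨a, ha, hne⟩ := Set.exists_ne_of_one_lt_ncard h3 0
  rcases ha with ha | ⟨u, hu, h0⟩
  · exact absurd ha hne
  · exact ⟨u, h0⟩

theorem RRM.count_places (M : RRM q deg prin ell g Can) (P : Place) :
    ∃ A : ℕ, ∀ (n : ℕ) (F : Finset Place), (∀ p ∈ F, deg p = n ∧ p ≠ P) →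
      F.card ≤ A * q ^ n := by
  classical
  obtain ⟨C, hC⟩ := M.ell_le P
  have hP := M.hdeg P
  refine ⟨(1 + g + deg P) * q ^ (g + deg P + C), fun n F hF => ?_⟩
  rcases Nat.eq_zero_or_pos n with hn | hn
  · have : F = ∅ := by
      refine Finset.eq_empty_of_forall_notMem fun p hp => ?_
      have := M.hdeg p
      have := (hF p hp).1
      omega
    simp [this]
  set k : ℕ := (n + g) / deg P + 1 with hk
  have hk1 : n + g ≤ k * deg P := by
    have := Nat.lt_div_mul_add (a := n + g) hP
    rw [hk, add_mul]; omega
  have hk2 : k * deg P ≤ n + g + deg P := by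
    have := Nat.div_mul_le_self (n + g) (deg P)
    rw [hk, add_mul]; omega
  set E : Place →₀ ℤ := Finsupp.single P (k : ℤ) with hE
  have hdE : divDeg deg E = ((k * deg P : ℕ) : ℤ) := by rw [hE, divDeg_single']; push_cast; rfl
  have hex : ∀ p : Place, ∃ u : Kˣ, p ∈ F → 0 ≤ prin u + (E - Finsupp.single p 1) := by
    intro p
    by_cases hp : p ∈ F
    · obtain ⟨u, hu⟩ := M.exists_unit (E - Finsupp.single p 1) (by
        rw [divDeg_sub', hdE, divDeg_single', (hF p hp).1]
        omega)
      exact ⟨u, fun _ => hu⟩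
    · exact ⟨1, fun h => absurd h hp⟩
  choose u hu using hex
  have hEle : ∀ p ∈ F, 0 ≤ prin (u p) + E := by
    intro p hp
    refine (hu p hp).trans ?_
    have : (0 : Place →₀ ℤ) ≤ Finsupp.single p 1 := Finsupp.single_nonneg.2 (by norm_num)
    gcongr
    exact sub_le_self _ this
  have hfib : ∀ a ∈ F.image (fun p => (u p : K)),
      (F.filter (fun p => (u p : K) = a)).card ≤ 1 + g + deg P := by
    intro a ha
    obtain ⟨p₀, hp₀, rfl⟩ := Finset.mem_image.1 ha
    have h1 := sum_deg_le deg (prin (u p₀) + E) (hEle p₀ hp₀)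
      (F.filter (fun p => (u p : K) = u p₀)) (by
        intro p hp
        rw [Finset.mem_filter] at hp
        have h2 := hu p hp.1 p
        rw [Units.ext hp.2] at h2
        simp only [Finsupp.coe_zero, Pi.zero_apply, Finsupp.coe_add, Finsupp.coe_sub, Pi.add_apply,
          Pi.sub_apply, Finsupp.single_eq_same] at h2 ⊢
        omega)
    rw [divDeg_add', M.hdegprin, hdE, Finset.sum_congr rfl (g := fun _ => (n : ℤ))
      (fun p hp => by rw [(hF p (Finset.mem_filter.1 hp).1).1])] at h1
    simp only [Finset.sum_const, nsmul_eq_mul, zero_add] at h1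
    have h3 : (F.filter (fun p => (u p : K) = u p₀)).card * n ≤ n + g + deg P := by
      have : (F.filter (fun p => (u p : K) = u p₀)).card * n ≤ k * deg P := by exact_mod_cast h1
      omega
    have h4 : n + g + deg P ≤ (1 + g + deg P) * n := by nlinarith
    exact Nat.le_of_mul_le_mul_right (h3.trans h4) hn
  have h1 := Finset.card_le_mul_card_image F _ hfib
  have h2 : (F.image (fun p => (u p : K))).card ≤ q ^ (n + g + deg P + C) := by
    rw [← Set.ncard_coe_finset]
    refine (Set.ncard_le_ncard (t := Lset prin E) ?_ (M.finite E)).trans ?_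
    · intro a ha
      obtain ⟨p, hp, rfl⟩ := Finset.mem_image.1 (Finset.mem_coe.1 ha)
      exact Or.inr ⟨u p, rfl, hEle p hp⟩
    · rw [M.ncard]
      refine Nat.pow_le_pow_right (by have := M.hq; omega) ?_
      have := hC E (by rw [hdE]; positivity)
      rw [hdE] at this
      omega
  calc F.card ≤ _ := h1
    _ ≤ (1 + g + deg P) * q ^ (n + g + deg P + C) := by gcongr
    _ = _ := by ring

theorem RRM.summable (M : RRM q deg prin ell g Can) (P : Place) (s : ℕ) (hs : 2 ≤ s)
    (S : Finset Place) (hPS : P ∈ S) :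
    Summable (fun p : {p : Place // p ∉ S} => ((q : ℝ) ^ (s * deg p.1))⁻¹) := by
  classical
  obtain ⟨A, hA⟩ := M.count_places P
  have hq1 : (1 : ℝ) < q := by have := M.hq; exact_mod_cast (by omega : 1 < q)
  have hq0 : (0 : ℝ) < q := by linarith
  have hsum : Summable (fun n : ℕ => ((q : ℝ)⁻¹) ^ n) :=
    summable_geometric_of_lt_one (by positivity) (inv_lt_one_of_one_lt₀ hq1)
  refine summable_of_sum_le (c := A * ∑' n : ℕ, ((q : ℝ)⁻¹) ^ n) (fun p => by positivity) ?_
  intro F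
  have hmap : ∀ p ∈ F, deg p.1 ∈ F.image (fun p => deg p.1) :=
    fun p hp => Finset.mem_image_of_mem _ hp
  rw [← Finset.sum_fiberwise_of_maps_to hmap]
  calc _ ≤ ∑ n ∈ F.image (fun p => deg p.1), A * ((q : ℝ)⁻¹) ^ n := by
        refine Finset.sum_le_sum fun n _ => ?_
        calc _ ≤ ∑ p ∈ F with deg p.1 = n, ((q : ℝ) ^ (2 * n))⁻¹ := by
              refine Finset.sum_le_sum fun p hp => ?_
              rw [(Finset.mem_filter.1 hp).2]
              gcongr
              exact hq1.le
          _ = ((F.filter (fun p => deg p.1 = n)).card : ℝ) * ((q : ℝ) ^ (2 * n))⁻¹ := by simp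
          _ ≤ (A * (q : ℝ) ^ n) * ((q : ℝ) ^ (2 * n))⁻¹ := by
              gcongr
              have := hA n ((F.filter (fun p => deg p.1 = n)).map (Function.Embedding.subtype _)) (by
                intro p hp
                simp only [Finset.mem_map, Finset.mem_filter] at hp
                obtain ⟨x, ⟨_, hx⟩, rfl⟩ := hp
                refine ⟨hx, ?_⟩
                intro h
                exact x.2 (by rw [show x.1 = P from h]; exact hPS))
              rw [Finset.card_map] at this
              exact_mod_cast this
          _ = _ := by
              rw [two_mul, pow_add, inv_pow]
              field_simp
    _ = A * ∑ n ∈ F.image (fun p => deg p.1), ((q : ℝ)⁻¹) ^ n := by rw [Finset.mul_sum]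
    _ ≤ _ := by
        gcongr
        exact hsum.sum_le_tsum _ (fun n _ => by positivity)

/-- tuples in `L(D)` -/
def LTup (prin : Kˣ → (Place →₀ ℤ)) (m : ℕ) (D : Place →₀ ℤ) : Set (Fin m → K) :=
  {f | ∀ l, f l ∈ Lset prin D}

def Bad (prin : Kˣ → (Place →₀ ℤ)) (m w : ℕ) (p : Place) (f : Fin m → K) : Prop :=
  ∀ l : Fin m, f l = 0 ∨ ∃ u : Kˣ, (u : K) = f l ∧ (w : ℤ) ≤ prin u p

theorem RRM.LT_finite (M : RRM q deg prin ell g Can) (m : ℕ) (D : Place →₀ ℤ) :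
    (LTup prin m D).Finite := by
  have : LTup prin m D = Set.pi Set.univ (fun _ => Lset prin D) := by
    ext f; simp [LTup]
  rw [this]
  exact Set.Finite.pi' (fun _ => M.finite D) |>.subset (by intro f hf; simpa using hf)

theorem RRM.LT_ncard (M : RRM q deg prin ell g Can) (m : ℕ) (D : Place →₀ ℤ) :
    (LTup prin m D).ncard = (q ^ ell D) ^ m := by
  have e : (LTup prin m D) ≃ (Fin m → Lset prin D) :=
    { toFun := fun f l => ⟨f.1 l, f.2 l⟩
      invFun := fun f => ⟨fun l => (f l).1, fun l => (f l).2⟩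
      left_inv := fun f => rfl
      right_inv := fun f => rfl }
  rw [← Nat.card_coe_set_eq, Nat.card_congr e, Nat.card_fun, M.hell]
  simp

theorem LT_bad (prin : Kˣ → (Place →₀ ℤ)) (m w : ℕ) (D : Place →₀ ℤ) (p : Place)
    (hp : D p = 0) (f : Fin m → K) :
    f ∈ LTup prin m (D - Finsupp.single p (w : ℤ)) ↔ f ∈ LTup prin m D ∧ Bad prin m w p f := by
  classical
  unfold LTup Bad
  simp only [Set.mem_setOf_eq]
  rw [← forall_and]
  refine forall_congr' fun l => ?_
  constructor
  · intro h
    refine ⟨Lset_mono prin (sub_le_self _ (Finsupp.single_nonneg.2 (by positivity))) h, ?_⟩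
    rcases h with h | ⟨u, hu, h0⟩
    · exact Or.inl h
    · refine Or.inr ⟨u, hu, ?_⟩
      have := h0 p
      simp only [Finsupp.coe_zero, Pi.zero_apply, Finsupp.coe_add, Finsupp.coe_sub, Pi.add_apply,
          Pi.sub_apply, Finsupp.single_eq_same] at this
      omega
  · rintro ⟨h | ⟨u, hu, h0⟩, h2⟩
    · exact Or.inl h
    · rcases h2 with h2 | ⟨v, hv, h1⟩
      · exact Or.inl h2
      · obtain rfl : u = v := Units.ext (hu.trans hv.symm)
        refine Or.inr ⟨u, hu, fun x => ?_⟩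
        have := h0 x
        simp only [Finsupp.coe_zero, Pi.zero_apply, Finsupp.coe_add, Finsupp.coe_sub, Pi.add_apply,
          Pi.sub_apply, Finsupp.single_apply] at this ⊢
        split_ifs with hx
        · subst hx; omega
        · omega

theorem RRM.count_good (M : RRM q deg prin ell g Can) (m w : ℕ) (F : Finset Place) :
    ∀ D : Place →₀ ℤ, (∀ p ∈ F, D p = 0) →
      2 * (g : ℤ) - 1 + ∑ p ∈ F, (w : ℤ) * deg p ≤ divDeg deg D →
      ({f | f ∈ LTup prin m D ∧ ∀ p ∈ F, ¬ Bad prin m w p f}.ncard : ℝ) =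
        ((q : ℝ) ^ ell D) ^ m * ∏ p ∈ F, (1 - ((q : ℝ) ^ (w * m * deg p))⁻¹) := by
  classical
  have hq0 : (0 : ℝ) < q := by have := M.hq; exact_mod_cast (by omega : 0 < q)
  induction F using Finset.induction_on with
  | empty =>
    intro D _ _
    simp only [Finset.notMem_empty, false_imp_iff, implies_true, and_true, Finset.prod_empty,
      mul_one, Set.ofPred_mem_eq]
    rw [M.LT_ncard]
    push_cast
    rfl
  | insert a F ha ih =>
    intro D hD hN
    rw [Finset.sum_insert ha] at hN
    have hwa : 0 ≤ (w : ℤ) * deg a := by positivity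
    have hsum : 0 ≤ ∑ p ∈ F, (w : ℤ) * deg p := Finset.sum_nonneg fun p _ => by positivity
    have hda := divDeg_single' deg a (w : ℤ)
    have hds := divDeg_sub' deg D (Finsupp.single a (w : ℤ))
    have h1 := ih D (fun p hp => hD p (Finset.mem_insert_of_mem hp)) (by omega)
    have h2 := ih (D - Finsupp.single a (w : ℤ)) (fun p hp => by
      have hne : p ≠ a := by rintro rfl; exact ha hp
      simp [hD p (Finset.mem_insert_of_mem hp), Finsupp.single_apply, hne.symm]) (by omega)
    have hl1 := M.ell_large D (by omega)
    have hl2 := M.ell_large (D - Finsupp.single a (w : ℤ)) (by omega)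
    have hl : ell D = ell (D - Finsupp.single a (w : ℤ)) + w * deg a := by
      have : (ell D : ℤ) = ell (D - Finsupp.single a (w : ℤ)) + w * deg a := by omega
      exact_mod_cast this
    have hsplit : {f | f ∈ LTup prin m D ∧ ∀ p ∈ F, ¬ Bad prin m w p f} =
        {f | f ∈ LTup prin m D ∧ ∀ p ∈ insert a F, ¬ Bad prin m w p f} ∪
        {f | f ∈ LTup prin m (D - Finsupp.single a (w : ℤ)) ∧ ∀ p ∈ F, ¬ Bad prin m w p f} := by
      ext f
      simp only [Set.mem_union, Set.mem_setOf_eq, Finset.forall_mem_insert,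
        LT_bad prin m w D a (hD a (Finset.mem_insert_self _ _))]
      by_cases hb : Bad prin m w a f <;> simp [hb]
    have hdisj : Disjoint {f | f ∈ LTup prin m D ∧ ∀ p ∈ insert a F, ¬ Bad prin m w p f}
        {f | f ∈ LTup prin m (D - Finsupp.single a (w : ℤ)) ∧ ∀ p ∈ F, ¬ Bad prin m w p f} := by
      rw [Set.disjoint_left]
      intro f
      simp only [Set.mem_setOf_eq, Finset.forall_mem_insert,
        LT_bad prin m w D a (hD a (Finset.mem_insert_self _ _))]
      tauto
    rw [hsplit, Set.ncard_union_eq hdisj ((M.LT_finite m _).subset fun f hf => hf.1)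
      ((M.LT_finite m _).subset fun f hf => hf.1)] at h1
    push_cast at h1
    rw [h2] at h1
    rw [Finset.prod_insert ha, eq_sub_of_add_eq h1, hl, show w * m * deg a = w * deg a * m by ring,
      pow_add, pow_mul (q : ℝ) (w * deg a) m]
    field_simp
    ring

theorem RRM.main (M : RRM q deg prin ell g Can) [DecidableEq Place] (S : Finset Place)
    (hS : S.Nonempty) (w m : ℕ) (hw : 1 ≤ w) (hm : 1 ≤ m) (hwm : 2 ≤ w * m) :
    ∀ ε > (0 : ℝ), ∃ N₀ : ℤ, ∀ D : Place →₀ ℤ, (∀ p, p ∉ S → D p = 0) → N₀ ≤ divDeg deg D →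
      |({f | f ∈ LTup prin m D ∧ wCoprimeElems prin S w f}.ncard : ℝ) / ((q : ℝ) ^ ell D) ^ m -
        (∏' p : {p : Place // p ∉ S},
            (1 - ((q : ℝ) ^ (w * m * deg p.1))⁻¹)⁻¹)⁻¹| < ε := by
  intro ε hε
  obtain ⟨P, hP⟩ := hS
  have hq2 : (2 : ℝ) ≤ q := by exact_mod_cast M.hq
  have hq1 : (1 : ℝ) < q := by linarith
  have hq0 : (0 : ℝ) < q := by linarith
  set x : {p : Place // p ∉ S} → ℝ := fun p => ((q : ℝ) ^ (w * m * deg p.1))⁻¹ with hx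
  have hsum : Summable x := M.summable P (w * m) hwm S hP
  have hx0 : ∀ p, 0 < x p := fun p => by simp only [hx]; positivity
  have hx1 : ∀ p, x p ≤ 1 / 2 := by
    intro p
    have h1 : (q : ℝ) ^ 1 ≤ (q : ℝ) ^ (w * m * deg p.1) := by
      refine pow_le_pow_right₀ hq1.le ?_
      have := M.hdeg p.1
      nlinarith
    rw [pow_one] at h1
    simp only [hx, one_div]
    exact inv_anti₀ (by norm_num) (hq2.trans h1)
  have hmult : Multipliable (fun p => (1 - x p)⁻¹) := by
    have h1 : Summable (fun p => (1 - x p)⁻¹ - 1) := by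
      refine Summable.of_nonneg_of_le (fun p => ?_) (fun p => ?_) (hsum.mul_left 2)
      · have := hx0 p
        have := hx1 p
        rw [sub_nonneg]
        exact (one_le_inv₀ (by linarith)).2 (by linarith)
      · have h2 := hx0 p
        have h3 := hx1 p
        have : (1 - x p)⁻¹ - 1 = x p * (1 - x p)⁻¹ := by
          have : 1 - x p ≠ 0 := by linarith
          field_simp
          ring
        rw [this, mul_comm]
        gcongr
        rw [inv_le_comm₀ (by linarith) (by norm_num)]
        linarith
    have h2 := Real.multipliable_one_add_of_summable h1
    simpa using h2
  have hZ1 : 1 ≤ ∏' p, (1 - x p)⁻¹ := by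
    refine ge_of_tendsto' hmult.hasProd fun F => ?_
    refine Finset.prod_induction _ (fun y => 1 ≤ y) (fun a b ha hb => one_le_mul_of_one_le_of_one_le ha hb) le_rfl ?_
    intro p _
    have := hx0 p
    have := hx1 p
    exact (one_le_inv₀ (by linarith)).2 (by linarith)
  have htend := hmult.hasProd.inv₀ (by linarith)
  simp only [inv_inv] at htend
  set Z := (∏' p, (1 - x p)⁻¹)⁻¹ with hZ
  obtain ⟨F₁, hF₁⟩ := Metric.tendsto_atTop.1
    (show Filter.Tendsto (fun F : Finset {p : Place // p ∉ S} => ∏ p ∈ F, (1 - x p))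
      Filter.atTop (nhds Z) from htend) (ε / 3) (by linarith)
  obtain ⟨C, hC⟩ := M.ell_le P
  set B : ℝ := ((q : ℝ) ^ (C + g)) ^ m with hB
  have hB0 : 0 < B := by positivity
  obtain ⟨F₂, hF₂⟩ := summable_iff_vanishing_norm.1 hsum (ε / (3 * B)) (by positivity)
  obtain ⟨k, hk⟩ := exists_pow_lt_of_lt_one (show 0 < ε / 3 by linarith) (inv_lt_one_of_one_lt₀ hq1)
  set F := F₁ ∪ F₂ with hF
  set Fp : Finset Place := F.map (Function.Embedding.subtype _) with hFp
  have hFpS : ∀ p ∈ Fp, p ∉ S := by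
    intro p hp
    obtain ⟨y, _, rfl⟩ := Finset.mem_map.1 hp
    exact y.2
  have hsumF : 0 ≤ ∑ p ∈ Fp, (w : ℤ) * deg p := Finset.sum_nonneg fun p _ => by positivity
  refine ⟨2 * g + ∑ p ∈ Fp, (w : ℤ) * deg p + k + g, fun D hD hN => ?_⟩
  have hl := M.ell_large D (by omega)
  have hkl : k ≤ ell D := by omega
  have hG := M.count_good m w Fp D (fun p hp => hD p (hFpS p hp)) (by omega)
  have hprod : ∏ p ∈ Fp, (1 - ((q : ℝ) ^ (w * m * deg p))⁻¹) = ∏ p ∈ F, (1 - x p) := by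
    rw [hFp, Finset.prod_map]; rfl
  rw [hprod] at hG
  set T : ℝ := ((q : ℝ) ^ ell D) ^ m with hT
  have hT0 : 0 < T := by positivity
  set G : Set (Fin m → K) := {f | f ∈ LTup prin m D ∧ ∀ p ∈ Fp, ¬ Bad prin m w p f} with hGdef
  set V : Set (Fin m → K) := {f | f ∈ LTup prin m D ∧ wCoprimeElems prin S w f} with hVdef
  have hGfin : G.Finite := (M.LT_finite m D).subset fun f hf => hf.1
  have hVfin : V.Finite := (M.LT_finite m D).subset fun f hf => hf.1
  have hVG : V ⊆ G := by
    rintro f ⟨h1, h2⟩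
    refine ⟨h1, fun p hp hbad => h2 ⟨p, hFpS p hp, hbad⟩⟩
  have hVle : (V.ncard : ℝ) ≤ G.ncard := by exact_mod_cast Set.ncard_le_ncard hVG hGfin
  have hfinQ : {p : {p : Place // p ∉ S} | p ∉ F ∧ (w : ℤ) * deg p.1 ≤ divDeg deg D}.Finite := by
    refine Set.Finite.subset ((M.hfin (divDeg deg D).toNat).preimage
      (Subtype.val_injective.injOn)) ?_
    rintro p ⟨_, hp⟩
    have : (deg p.1 : ℤ) ≤ divDeg deg D := by
      refine le_trans ?_ hp
      have : (1 : ℤ) ≤ w := by exact_mod_cast hw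
      nlinarith [Int.natCast_nonneg (deg p.1)]
    simp only [Set.mem_preimage, Set.mem_setOf_eq]
    omega
  set Q := hfinQ.toFinset with hQ
  have hsub : G ⊆ V ∪ ({0} ∪ ⋃ p ∈ Q, LTup prin m (D - Finsupp.single p.1 (w : ℤ))) := by
    rintro f ⟨h1, h2⟩
    by_cases hV : wCoprimeElems prin S w f
    · exact Or.inl ⟨h1, hV⟩
    right
    unfold wCoprimeElems at hV
    rw [not_not] at hV
    obtain ⟨p, hpS, hp⟩ := hV
    have hmem := (LT_bad prin m w D p (hD p hpS) f).2 ⟨h1, hp⟩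
    by_cases hN2 : (w : ℤ) * deg p ≤ divDeg deg D
    · right
      simp only [Set.mem_iUnion]
      refine ⟨⟨p, hpS⟩, ?_, hmem⟩
      rw [hQ, Set.Finite.mem_toFinset]
      refine ⟨fun hpF => h2 p ?_ hp, hN2⟩
      exact Finset.mem_map.2 ⟨_, hpF, rfl⟩
    · left
      refine funext fun l => M.eq_zero _ ?_ _ (hmem l)
      rw [divDeg_sub', divDeg_single']
      omega
  have hUfin : (⋃ p ∈ Q, LTup prin m (D - Finsupp.single p.1 (w : ℤ))).Finite :=
    Q.finite_toSet.biUnion fun p _ => M.LT_finite m _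
  have hcard : (G.ncard : ℝ) ≤ V.ncard + (1 + ∑ p ∈ Q,
      ((LTup prin m (D - Finsupp.single p.1 (w : ℤ))).ncard : ℝ)) := by
    have h1 := Set.ncard_le_ncard hsub (hVfin.union ((Set.finite_singleton _).union hUfin))
    have h2 := Set.ncard_union_le V
      ({0} ∪ ⋃ p ∈ Q, LTup prin m (D - Finsupp.single p.1 (w : ℤ)))
    have h3 := Set.ncard_union_le {0} (⋃ p ∈ Q, LTup prin m (D - Finsupp.single p.1 (w : ℤ)))
    have h4 := Finset.set_ncard_biUnion_le Q
      (fun p => LTup prin m (D - Finsupp.single p.1 (w : ℤ)))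
    rw [Set.ncard_singleton] at h3
    have h5 : G.ncard ≤ V.ncard + (1 + ∑ p ∈ Q,
      (LTup prin m (D - Finsupp.single p.1 (w : ℤ))).ncard) := by omega
    exact_mod_cast h5
  have hterm : ∀ p ∈ Q, ((LTup prin m (D - Finsupp.single p.1 (w : ℤ))).ncard : ℝ)
      ≤ T * B * x p := by
    intro p hp
    rw [hQ, Set.Finite.mem_toFinset] at hp
    have hp2 : (w : ℤ) * deg p.1 ≤ divDeg deg D := hp.2
    have h1 := hC (D - Finsupp.single p.1 (w : ℤ)) (by
      rw [divDeg_sub', divDeg_single']; omega)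
    rw [divDeg_sub', divDeg_single'] at h1
    have h2 : ell (D - Finsupp.single p.1 (w : ℤ)) + w * deg p.1 ≤ ell D + (C + g) := by
      have : (ell (D - Finsupp.single p.1 (w : ℤ)) : ℤ) + w * deg p.1 ≤ ell D + (C + g) := by
        omega
      exact_mod_cast this
    rw [M.LT_ncard]
    push_cast
    simp only [hx]
    rw [← div_eq_mul_inv, le_div_iff₀ (by positivity),
      show w * m * deg p.1 = w * deg p.1 * m by ring, pow_mul (q : ℝ) (w * deg p.1) m,
      hT, hB, ← mul_pow, ← mul_pow, ← pow_add, ← pow_add]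
    gcongr
    exact hq1.le
  have hQdisj : Disjoint Q F₂ := by
    rw [Finset.disjoint_left]
    intro p hp hp2
    rw [hQ, Set.Finite.mem_toFinset] at hp
    exact hp.1 (Finset.mem_union_right _ hp2)
  have htail := hF₂ Q hQdisj
  rw [Real.norm_of_nonneg (Finset.sum_nonneg fun p _ => (hx0 p).le), lt_div_iff₀ (by positivity)]
    at htail
  have hbound : (G.ncard : ℝ) ≤ V.ncard + (1 + T * B * ∑ p ∈ Q, x p) := by
    refine hcard.trans ?_
    rw [Finset.mul_sum]
    gcongr with p hp
    exact hterm p hp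
  have hTinv : T⁻¹ < ε / 3 := by
    refine lt_of_le_of_lt ?_ hk
    rw [hT, inv_pow, ← pow_mul]
    refine inv_anti₀ (by positivity) (pow_le_pow_right₀ hq1.le ?_)
    nlinarith
  have hmainF := hF₁ F Finset.subset_union_left
  rw [Real.dist_eq] at hmainF
  have hdiv1 : (V.ncard : ℝ) / T ≤ ∏ p ∈ F, (1 - x p) := by
    rw [div_le_iff₀ hT0]; linarith
  have hdiv2 : ∏ p ∈ F, (1 - x p) ≤ (V.ncard : ℝ) / T + (T⁻¹ + B * ∑ p ∈ Q, x p) := by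
    have : (V.ncard : ℝ) / T + (T⁻¹ + B * ∑ p ∈ Q, x p) =
        (V.ncard + (1 + T * B * ∑ p ∈ Q, x p)) / T := by
      field_simp
    rw [this, le_div_iff₀ hT0]
    linarith
  rw [abs_lt] at hmainF ⊢
  constructor <;> linarith [hmainF.1, hmainF.2]

end

/-- Corollary 1 (density of `w`-coprime `S`-integers): for `w, m ≥ 1` with
`wm ≥ 2`, the ratio `V_m^w(N⃗) / κ_m(N⃗)` tends to `1/ζ_S(wm)` as
`N = deg D(N⃗) → ∞`, where `κ_m(N⃗) = Card(L(D(N⃗))^m) = q^{m ℓ(D(N⃗))}`: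
the probability that `m` random elements of `L(D(N⃗))` are `w`-coprime tends
to `1/ζ_S(wm)`. -/
theorem density_w_coprime_S_integers
    {Fq K Place : Type*} [Field Fq] [Fintype Fq] [Field K] [Algebra Fq K]
    [DecidableEq Place]

    (q : ℕ) (hq : Fintype.card Fq = q)
    (deg : Place → ℕ) (hdeg : ∀ p, 0 < deg p)
    (hfin : ∀ n : ℕ, {p : Place | deg p ≤ n}.Finite)
    (prin : Kˣ → (Place →₀ ℤ))
    (hmul : ∀ a b : Kˣ, prin (a * b) = prin a + prin b)
    (hadd : ∀ a b c : Kˣ, (a : K) + (b : K) = (c : K) →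
      ∀ p, min (prin a p) (prin b p) ≤ prin c p)
    (hconst : ∀ c : Fqˣ, prin (Units.map (algebraMap Fq K).toMonoidHom c) = 0)
    (hdegprin : ∀ u : Kˣ, divDeg deg (prin u) = 0)
    (ell : (Place →₀ ℤ) → ℕ)
    (hell : ∀ D : Place →₀ ℤ, Nat.card (Lset prin D) = q ^ ell D)
    (g : ℕ) (Can : Place →₀ ℤ)
    (hRR : ∀ D : Place →₀ ℤ,
      (ell D : ℤ) = divDeg deg D - g + 1 + ell (Can - D))
    (hCan : divDeg deg Can = 2 * (g : ℤ) - 2)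
    (S : Finset Place) (hS : S.Nonempty)
    (w m : ℕ) (hw : 1 ≤ w) (hm : 1 ≤ m) (hwm : 2 ≤ w * m) :
    ∀ ε > (0 : ℝ), ∃ N₀ : ℤ, ∀ Nv : Place → ℤ,
      N₀ ≤ ∑ p ∈ S, Nv p * (deg p : ℤ) →
      |(Nat.card {f : Fin m → K //
            (∀ l, f l ∈ Lset prin (DofN S Nv)) ∧ wCoprimeElems prin S w f} : ℝ) /
          (Nat.card (Lset prin (DofN S Nv)) : ℝ) ^ m -
        (∏' p : {p : Place // p ∉ S},
            (1 - ((q : ℝ) ^ (w * m * deg p.1))⁻¹)⁻¹)⁻¹| < ε := by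
  have M : RRM q deg prin ell g Can :=
    ⟨hq ▸ Fintype.one_lt_card, hdeg, hfin, hdegprin, hell, hRR, hCan⟩
  intro ε hε
  obtain ⟨N₀, h⟩ := M.main S hS w m hw hm hwm ε hε
  refine ⟨N₀, fun Nv hN => ?_⟩
  have := h (DofN S Nv) (fun p hp => DofN_apply S Nv p hp) (by rw [divDeg_DofN]; exact hN)
  rw [hell]
  push_cast
  exact this
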